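/- arXiv:2208.03788 — 3 statements merged into one kernel-verified Lean document; each statement's English description precedes it below -/
import Mathlib

section
/- Let m, n ≥ 3 be natural numbers, both odd. Then M(P_m × P_n) ∈ {r, r+1}, where r = mn(m+n)/2 − (m+n)/2 − 1. -/
/-- The Manhattan distance between two vertices of the grid graph `P_m × P_n`. -/
def gridDist {m n : ℕ} (p q : Fin m × Fin n) : ℕ :=
  Nat.dist p.1 q.1 + Nat.dist p.2 q.2

/-- The length of the walk induced by a labeling (bijection) `σ` of the vertices of
`P_m × P_n` by `{1, …, mn}`: the sum of Manhattan distances between consecutively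
labeled vertices. -/
def walkLen (m n : ℕ) (σ : Fin m × Fin n ≃ Fin (m * n)) : ℕ :=
  ∑ t : Fin (m * n - 1),
    gridDist (σ.symm (t.castLE (by omega))) (σ.symm ⟨t.val + 1, by omega⟩)

/-- `M(P_m × P_n)`: the maximal length of a walk induced by a labeling of `P_m × P_n`. -/
noncomputable def maxWalk (m n : ℕ) : ℕ := sSup (Set.range (walkLen m n))

/-- The sum of the distances from the two endpoints of every edge to a fixed vertex `c`, in terms
of the sum over all vertices. -/
lemma sum_consecutive_add_ends {m n : ℕ} (h : 0 < m * n) (σ : Fin m × Fin n ≃ Fin (m * n))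
    (c : Fin m × Fin n) :
    ∑ t : Fin (m * n - 1), (gridDist (σ.symm (t.castLE (by omega))) c
        + gridDist (σ.symm ⟨t.val + 1, by omega⟩) c)
      + gridDist (σ.symm ⟨0, h⟩) c + gridDist (σ.symm ⟨m * n - 1, by omega⟩) c
      = 2 * ∑ p, gridDist p c := by
  have key : ∀ (N : ℕ) (_ : 0 < N) (f : Fin N → ℕ),
      ∑ t : Fin (N - 1), (f (t.castLE (by omega)) + f ⟨t.val + 1, by omega⟩)
        + f ⟨0, by omega⟩ + f ⟨N - 1, by omega⟩ = 2 * ∑ t, f t := by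
    intro N hN f
    obtain ⟨k, rfl⟩ : ∃ k, N = k + 1 := ⟨N - 1, by omega⟩
    have h₁ := Fin.sum_univ_succ f
    have h₂ := Fin.sum_univ_castSucc f
    change ∑ t : Fin k, (f t.castSucc + f t.succ) + f 0 + f (Fin.last k) = _
    rw [Finset.sum_add_distrib]
    omega
  rw [← Equiv.sum_comp σ.symm]
  exact key _ h fun t => gridDist (σ.symm t) c

lemma gridDist_le_add {m n : ℕ} (p q c : Fin m × Fin n) :
    gridDist p q ≤ gridDist p c + gridDist q c := by
  simp only [gridDist, Nat.dist]
  omega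

lemma walkLen_le {m n : ℕ} (σ : Fin m × Fin n ≃ Fin (m * n)) (c : Fin m × Fin n) :
    walkLen m n σ ≤ 2 * ∑ p, gridDist p c := by
  have h : 0 < m * n := Nat.mul_pos c.1.pos c.2.pos
  rw [← sum_consecutive_add_ends h σ c, add_assoc]
  exact le_add_right (Finset.sum_le_sum fun t _ => gridDist_le_add _ _ _)

/-- The central vertex of the grid `P_{2a+1} × P_{2b+1}`. -/
def gridCenter (a b : ℕ) : Fin (2 * a + 1) × Fin (2 * b + 1) :=
  (⟨a, by omega⟩, ⟨b, by omega⟩)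

lemma sum_dist_middle (a : ℕ) : ∑ i : Fin (2 * a + 1), Nat.dist i a = a * (a + 1) := by
  rw [Fin.sum_univ_eq_sum_range fun i => Nat.dist i a]
  induction a with
  | zero => simp
  | succ a ih =>
    rw [show 2 * (a + 1) + 1 = (2 * a + 1 + 1) + 1 by ring, Finset.sum_range_succ',
      Finset.sum_range_succ]
    simp only [Nat.dist_add_add_right, ih]
    simp only [Nat.dist]
    have : 2 * a + 1 - a + (a - (2 * a + 1)) + (0 - (a + 1) + (a + 1 - 0)) = 2 * (a + 1) := by
      omega
    rw [add_assoc, this]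
    ring

lemma two_mul_sum_gridDist_gridCenter (a b : ℕ) :
    2 * ∑ p, gridDist p (gridCenter a b) + (a + b + 1)
      = (2 * a + 1) * (2 * b + 1) * (a + b + 1) := by
  have : ∑ p, gridDist p (gridCenter a b)
      = (2 * b + 1) * (a * (a + 1)) + (2 * a + 1) * (b * (b + 1)) := by
    simp only [gridDist, gridCenter, Fintype.sum_prod_type, Finset.sum_add_distrib,
      Finset.sum_const, Finset.card_univ, Fintype.card_fin, smul_eq_mul, sum_dist_middle,
      ← Finset.mul_sum]
  rw [this]
  ring

/-- An enumeration, relative to the centre, of one vertex out of each pair of non-central antipodal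
vertices of `P_{2a+1} × P_{2b+1}`: first the rows to the right of the centre, from top to bottom,
then the vertices below the centre, from bottom to top. -/
def halfGrid (a b k : ℕ) : ℤ × ℤ :=
  if k < a * (2 * b + 1) then (1 + (k % a : ℕ), b - (k / a : ℕ))
  else (0, k - (a * (2 * b + 1) : ℕ) - b)

/-- The walk, relative to the centre, that starts at the centre and visits each vertex of `halfGrid`
followed by its antipode. -/
def antipodalWalk (a b t : ℕ) : ℤ × ℤ :=
  if t = 0 then 0
  else if t % 2 = 1 then halfGrid a b ((t - 1) / 2) else -halfGrid a b ((t - 1) / 2)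

section halfGrid

variable {a b k l : ℕ}

lemma halfGrid_bounds (ha : 0 < a) (hk : k < a * (2 * b + 1) + b) :
    (0 < (halfGrid a b k).1 ∨ (halfGrid a b k).1 = 0 ∧ (halfGrid a b k).2 < 0) ∧
      (halfGrid a b k).1 ≤ a ∧ -b ≤ (halfGrid a b k).2 ∧ (halfGrid a b k).2 ≤ b := by
  unfold halfGrid
  split_ifs with h
  · have h₁ := Nat.mod_lt k ha
    have h₂ := Nat.div_lt_of_lt_mul h
    dsimp only
    generalize k % a = x at *
    generalize k / a = y at *
    omega
  · dsimp only
    omega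

lemma halfGrid_injective (h : halfGrid a b k = halfGrid a b l) : k = l := by
  unfold halfGrid at h
  split_ifs at h with hk hl hl
  · rw [Prod.mk.injEq] at h
    rw [← Nat.div_add_mod k a, ← Nat.div_add_mod l a, show k / a = l / a by omega,
      show k % a = l % a by omega]
  all_goals
    rw [Prod.mk.injEq] at h
    omega

/-- Consecutive vertices of `halfGrid` lie in a common closed quadrant. -/
lemma halfGrid_succ (ha : 0 < a) (hk : k + 1 < a * (2 * b + 1) + b) :
    0 ≤ (halfGrid a b k).1 ∧ 0 ≤ (halfGrid a b (k + 1)).1 ∧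
      (0 ≤ (halfGrid a b k).2 ∧ 0 ≤ (halfGrid a b (k + 1)).2 ∨
        (halfGrid a b k).2 ≤ 0 ∧ (halfGrid a b (k + 1)).2 ≤ 0) := by
  have h₀ := (halfGrid_bounds ha (by omega : k < a * (2 * b + 1) + b)).1
  have h₁ := (halfGrid_bounds ha hk).1
  refine ⟨by omega, by omega, ?_⟩
  unfold halfGrid
  split_ifs with h h' h'
  · have : (k + 1) / a ≤ k / a + 1 := by
      rw [← Nat.add_div_right k ha]
      exact Nat.div_le_div_right (by omega)
    have : k / a ≤ (k + 1) / a := Nat.div_le_div_right (by omega)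
    dsimp only
    omega
  · have : k / a = 2 * b := by
      apply Nat.div_eq_of_lt_le <;> nlinarith
    dsimp only
    omega
  · omega
  · dsimp only
    omega

end halfGrid

section antipodalWalk

variable {a b t u : ℕ}

lemma antipodalWalk_bounds (ha : 0 < a) (ht : t < (2 * a + 1) * (2 * b + 1)) :
    -a ≤ (antipodalWalk a b t).1 ∧ (antipodalWalk a b t).1 ≤ a ∧
      -b ≤ (antipodalWalk a b t).2 ∧ (antipodalWalk a b t).2 ≤ b := by
  simp only [antipodalWalk, apply_ite Prod.fst, apply_ite Prod.snd, Prod.fst_neg, Prod.snd_neg,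
    Prod.fst_zero, Prod.snd_zero]
  split_ifs with h₀
  · omega
  all_goals
    have := halfGrid_bounds ha (by lia : (t - 1) / 2 < a * (2 * b + 1) + b)
    omega

lemma antipodalWalk_injective (ha : 0 < a) (ht : t < (2 * a + 1) * (2 * b + 1))
    (hu : u < (2 * a + 1) * (2 * b + 1)) (h : antipodalWalk a b t = antipodalWalk a b u) :
    t = u := by
  have ht' : t ≠ 0 → _ := fun h =>
    (halfGrid_bounds ha (by lia : (t - 1) / 2 < a * (2 * b + 1) + b)).1
  have hu' : u ≠ 0 → _ := fun h =>
    (halfGrid_bounds ha (by lia : (u - 1) / 2 < a * (2 * b + 1) + b)).1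
  have h₁ := congrArg Prod.fst h
  have h₂ := congrArg Prod.snd h
  have h₃ := @halfGrid_injective a b ((t - 1) / 2) ((u - 1) / 2)
  rw [Prod.ext_iff] at h₃
  simp only [antipodalWalk, apply_ite Prod.fst, apply_ite Prod.snd, Prod.fst_neg, Prod.snd_neg,
    Prod.fst_zero, Prod.snd_zero] at h₁ h₂
  split_ifs at h₁ h₂ <;> omega

/-- Every step of the walk crosses both axes through the centre. -/
lemma antipodalWalk_succ (ha : 0 < a) (ht : t + 1 < (2 * a + 1) * (2 * b + 1)) :
    ((antipodalWalk a b t).1 - (antipodalWalk a b (t + 1)).1).natAbs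
        = (antipodalWalk a b t).1.natAbs + (antipodalWalk a b (t + 1)).1.natAbs ∧
      ((antipodalWalk a b t).2 - (antipodalWalk a b (t + 1)).2).natAbs
        = (antipodalWalk a b t).2.natAbs + (antipodalWalk a b (t + 1)).2.natAbs := by
  obtain rfl | ⟨k, rfl⟩ | ⟨k, rfl⟩ :
      t = 0 ∨ (∃ k, t = 2 * k + 1) ∨ ∃ k, t = 2 * k + 2 := by
    obtain ⟨k, hk | hk⟩ := t.even_or_odd'
    · rcases k with _ | k
      · exact Or.inl hk
      · exact Or.inr (Or.inr ⟨k, hk⟩)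
    · exact Or.inr (Or.inl ⟨k, hk⟩)
  · simp [antipodalWalk]
  · rw [antipodalWalk, antipodalWalk, if_neg (by omega), if_pos (by omega), if_neg (by omega),
      if_neg (by omega), show (2 * k + 1 - 1) / 2 = k by omega,
      show (2 * k + 1 + 1 - 1) / 2 = k by omega]
    simp only [Prod.fst_neg, Prod.snd_neg]
    omega
  · have h := halfGrid_succ ha (by lia : k + 1 < a * (2 * b + 1) + b)
    rw [antipodalWalk, antipodalWalk, if_neg (by omega), if_neg (by omega), if_neg (by omega),
      if_pos (by omega), show (2 * k + 2 - 1) / 2 = k by omega,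
      show (2 * k + 2 + 1 - 1) / 2 = k + 1 by omega]
    simp only [Prod.fst_neg, Prod.snd_neg]
    omega

/-- The walk ends at the upper neighbour of the centre. -/
lemma antipodalWalk_last (hb : 0 < b) :
    antipodalWalk a b ((2 * a + 1) * (2 * b + 1) - 1) = (0, 1) := by
  have h : (2 * a + 1) * (2 * b + 1) = 2 * (a * (2 * b + 1) + b) + 1 := by ring
  rw [antipodalWalk, if_neg (by omega), if_neg (by omega), halfGrid, if_neg (by omega)]
  ext <;> simp only [Prod.fst_neg, Prod.snd_neg] <;> omega

end antipodalWalk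

lemma dist_toNat_add {c : ℕ} {x y : ℤ} (hx : -c ≤ x) (hy : -c ≤ y)
    (h : (x - y).natAbs = x.natAbs + y.natAbs) :
    Nat.dist (c + x).toNat (c + y).toNat
      = Nat.dist (c + x).toNat c + Nat.dist (c + y).toNat c := by
  simp only [Nat.dist]
  omega

lemma exists_walkLen_add_one_eq {a b : ℕ} (ha : 0 < a) (hb : 0 < b) :
    ∃ σ, walkLen (2 * a + 1) (2 * b + 1) σ + 1 = 2 * ∑ p, gridDist p (gridCenter a b) := by
  let g : Fin ((2 * a + 1) * (2 * b + 1)) → Fin (2 * a + 1) × Fin (2 * b + 1) := fun t =>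
    (⟨(a + (antipodalWalk a b t).1).toNat, by
        have := antipodalWalk_bounds ha t.isLt
        omega⟩,
      ⟨(b + (antipodalWalk a b t).2).toNat, by
        have := antipodalWalk_bounds ha t.isLt
        omega⟩)
  have hg : g.Injective := by
    intro t u h
    have ht := antipodalWalk_bounds ha t.isLt
    have hu := antipodalWalk_bounds ha u.isLt
    simp only [g, Prod.mk.injEq, Fin.mk.injEq] at h
    exact Fin.ext (antipodalWalk_injective ha t.isLt u.isLt
      (Prod.ext (by omega) (by omega)))
  have hg' : g.Bijective :=
    (Fintype.bijective_iff_injective_and_card g).2 ⟨hg, by simp⟩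
  let σ := (Equiv.ofBijective g hg').symm
  have hσ : ∀ t, σ.symm t = g t := fun _ => rfl
  refine ⟨σ, ?_⟩
  rw [← sum_consecutive_add_ends (by positivity) σ]
  have first : gridDist (σ.symm ⟨0, by positivity⟩) (gridCenter a b) = 0 := by
    simp [hσ, g, gridDist, gridCenter, antipodalWalk]
  have last : gridDist (σ.symm ⟨(2 * a + 1) * (2 * b + 1) - 1, by lia⟩) (gridCenter a b) = 1 := by
    simp only [hσ, g, gridDist, gridCenter, antipodalWalk_last hb, Nat.dist]
    omega
  rw [first, last, add_zero, walkLen]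
  congr 1
  refine Finset.sum_congr rfl fun t _ => ?_
  have ht : t.val + 1 < (2 * a + 1) * (2 * b + 1) := by omega
  have h := antipodalWalk_succ ha ht
  have h₁ := antipodalWalk_bounds ha ht
  have h₂ := antipodalWalk_bounds ha (Nat.lt_of_succ_lt ht)
  simp only [hσ, g, gridDist, gridCenter, Fin.val_castLE]
  rw [dist_toNat_add h₂.1 h₁.1 h.1, dist_toNat_add h₂.2.2.1 h₁.2.2.1 h.2, add_add_add_comm]

theorem maxWalk_odd_odd (m n : ℕ) (hm : 3 ≤ m) (hn : 3 ≤ n)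
    (hmo : Odd m) (hno : Odd n) :
    maxWalk m n ∈
      ({m * n * (m + n) / 2 - (m + n) / 2 - 1,
        m * n * (m + n) / 2 - (m + n) / 2 - 1 + 1} : Set ℕ) := by
  obtain ⟨a, rfl⟩ := hmo
  obtain ⟨b, rfl⟩ := hno
  have upper : ∀ l ∈ Set.range (walkLen (2 * a + 1) (2 * b + 1)),
      l ≤ 2 * ∑ p, gridDist p (gridCenter a b) := by
    rintro _ ⟨σ, rfl⟩
    exact walkLen_le σ _
  obtain ⟨σ, hσ⟩ := exists_walkLen_add_one_eq (by omega : 0 < a) (by omega : 0 < b)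
  have h₁ : maxWalk (2 * a + 1) (2 * b + 1) ≤ _ := csSup_le ⟨_, σ, rfl⟩ upper
  have h₂ : walkLen _ _ σ ≤ maxWalk (2 * a + 1) (2 * b + 1) := le_csSup ⟨_, upper⟩ ⟨σ, rfl⟩
  have h₃ := two_mul_sum_gridDist_gridCenter a b
  have h₄ : (2 * a + 1) * (2 * b + 1) * (2 * a + 1 + (2 * b + 1)) / 2
      = (2 * a + 1) * (2 * b + 1) * (a + b + 1) := by
    rw [show 2 * a + 1 + (2 * b + 1) = (a + b + 1) * 2 by ring, ← mul_assoc,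
      Nat.mul_div_cancel _ two_pos]
  rw [h₄, Set.mem_insert_iff, Set.mem_singleton_iff]
  omega
end

section
/- For every natural number n ≥ 2, M(P_2 × P_n) ∈ {r, r+1}, where r = (n+1)² − 4. -/
theorem sum_range_dist_center (n : ℕ) :
    ∑ j ∈ Finset.range n, Nat.dist (2 * j + 1) n = n ^ 2 / 2 := by
  induction n using Nat.twoStepInduction with
  | zero => simp
  | one => simp
  | more n ih _ =>
    rw [Finset.sum_range_succ, Finset.sum_range_succ']
    have h : ∀ j, Nat.dist (2 * (j + 1) + 1) (n + 2) = Nat.dist (2 * j + 1) n := by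
      intro j; simp only [Nat.dist]; omega
    simp only [h, ih]
    have e : (n + 2) ^ 2 = n ^ 2 + 2 * (2 * (n + 1)) := by ring
    rw [e, Nat.add_mul_div_left _ _ (by norm_num)]
    simp only [Nat.dist]
    omega

/-- Summing a function over consecutive pairs counts every point twice, except for the ends. -/
theorem sum_consecutive {M : ℕ} (a : Fin (M + 1) → ℕ) :
    ∑ t : Fin M, (a t.castSucc + a t.succ) + (a 0 + a (Fin.last M)) = 2 * ∑ t, a t := by
  have h₁ := Fin.sum_univ_castSucc a
  have h₂ := Fin.sum_univ_succ a
  rw [Finset.sum_add_distrib]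
  omega

theorem two_mul_gridDist_le {n : ℕ} (p q : Fin 2 × Fin n) :
    2 * gridDist p q ≤ 2 + (Nat.dist (2 * p.2 + 1) n + Nat.dist (2 * q.2 + 1) n) := by
  obtain ⟨a, b⟩ := p
  obtain ⟨c, d⟩ := q
  simp only [gridDist, Nat.dist]
  omega

theorem sum_dist_center_two_rows (n : ℕ) :
    ∑ p : Fin 2 × Fin n, Nat.dist (2 * p.2 + 1) n = 2 * (n ^ 2 / 2) := by
  simp only [Fintype.sum_prod_type, Fin.sum_univ_eq_sum_range (fun j => Nat.dist (2 * j + 1) n),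
    sum_range_dist_center, Fin.sum_univ_two, two_mul (n ^ 2 / 2)]

theorem sum_gridDist_le {n M : ℕ} (hM : M + 1 = 2 * n) (p : Fin (M + 1) ≃ Fin 2 × Fin n) :
    ∑ t : Fin M, gridDist (p t.castSucc) (p t.succ) ≤ (n + 1) ^ 2 - 3 := by
  have h := sum_consecutive fun t => Nat.dist (2 * (p t).2 + 1) n
  rw [Equiv.sum_comp p fun q => Nat.dist (2 * q.2 + 1) n, sum_dist_center_two_rows] at h
  have hle : 2 * ∑ t : Fin M, gridDist (p t.castSucc) (p t.succ) ≤ 2 * M +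
      ∑ t : Fin M, (Nat.dist (2 * (p t.castSucc).2 + 1) n + Nat.dist (2 * (p t.succ).2 + 1) n) := by
    rw [Finset.mul_sum]
    refine (Finset.sum_le_sum fun t _ => two_mul_gridDist_le _ _).trans_eq ?_
    rw [Finset.sum_add_distrib]
    simp [mul_comm]
  have hsq : (n + 1) ^ 2 = n ^ 2 + 2 * n + 1 := by ring
  rcases Nat.even_or_odd' n with ⟨k, rfl | rfl⟩
  · have h0 : ∀ x : Fin (2 * k), 1 ≤ Nat.dist (2 * x + 1) (2 * k) := by
      intro x; simp only [Nat.dist]; omega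
    have := h0 (p 0).2
    have := h0 (p (Fin.last M)).2
    omega
  · have : (2 * k + 1) ^ 2 = 2 * (2 * k ^ 2 + 2 * k) + 1 := by ring
    omega

theorem walkLen_le_s3 (n : ℕ) (hn : 2 ≤ n) (σ : Fin 2 × Fin n ≃ Fin (2 * n)) :
    walkLen 2 n σ ≤ (n + 1) ^ 2 - 3 := by
  have hM : 2 * n - 1 + 1 = 2 * n := by omega
  exact sum_gridDist_le hM ((finCongr hM).trans σ.symm)

/-- A sequence of `2 * n` distinct vertices of `P_2 × P_n`, given by its rows and columns,
is induced by a labeling. -/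
theorem exists_walkLen_eq (n : ℕ) (row col : ℕ → ℕ)
    (hrow : ∀ t < 2 * n, row t < 2) (hcol : ∀ t < 2 * n, col t < n)
    (hinj : ∀ s < 2 * n, ∀ t < 2 * n, row s = row t → col s = col t → s = t) :
    ∃ σ, walkLen 2 n σ = ∑ t ∈ Finset.range (2 * n - 1),
      (Nat.dist (row t) (row (t + 1)) + Nat.dist (col t) (col (t + 1))) := by
  let p : Fin (2 * n) → Fin 2 × Fin n := fun t => (⟨row t, hrow t t.2⟩, ⟨col t, hcol t t.2⟩)
  have hp : Function.Bijective p := by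
    rw [Fintype.bijective_iff_injective_and_card]
    refine ⟨fun s t h => ?_, by simp⟩
    simp only [p, Prod.mk.injEq, Fin.mk.injEq] at h
    exact Fin.ext (hinj s s.2 t t.2 h.1 h.2)
  refine ⟨(Equiv.ofBijective p hp).symm, ?_⟩
  rw [← Fin.sum_univ_eq_sum_range
    (fun t => Nat.dist (row t) (row (t + 1)) + Nat.dist (col t) (col (t + 1)))]
  rfl

theorem sum_range_two_mul_sub_one (n : ℕ) (hn : 1 ≤ n) (f : ℕ → ℕ) :
    ∑ t ∈ Finset.range (2 * n - 1), f t =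
      ∑ t ∈ Finset.range (n - 1), (f t + f (n + t)) + f (n - 1) := by
  obtain ⟨m, rfl⟩ := Nat.exists_eq_add_of_le' hn
  rw [show 2 * (m + 1) - 1 = (m + 1) + m by omega, Finset.sum_range_add, Finset.sum_range_succ,
    Finset.sum_add_distrib]
  simp only [Nat.add_sub_cancel]
  ring

theorem exists_walkLen_even (k : ℕ) (hk : 1 ≤ k) :
    ∃ σ, walkLen 2 (2 * k) σ = (2 * k + 1) ^ 2 - 4 := by
  let row : ℕ → ℕ := fun t => if t < 2 * k then t % 2 else (t + 1) % 2
  let col : ℕ → ℕ := fun t =>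
    if t < 2 * k then (if t % 2 = 0 then k - 1 - t / 2 else k + t / 2)
    else (if t % 2 = 0 then t / 2 - k else 3 * k - 1 - t / 2)
  obtain ⟨σ, hσ⟩ := exists_walkLen_eq (2 * k) row col
    (by intro t ht; simp only [row]; split_ifs <;> omega)
    (by intro t ht; simp only [col]; split_ifs <;> omega)
    (by intro s hs t ht; simp only [row, col]; split_ifs <;> omega)
  refine ⟨σ, hσ.trans ?_⟩
  rw [sum_range_two_mul_sub_one _ (by omega), Finset.sum_congr rfl (g := fun _ => 2 * k + 2)]
  · have : Nat.dist (row (2 * k - 1)) (row (2 * k - 1 + 1)) +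
        Nat.dist (col (2 * k - 1)) (col (2 * k - 1 + 1)) = 2 * k - 1 := by
      simp only [row, col, Nat.dist]; split_ifs <;> omega
    rw [this]
    obtain ⟨j, rfl⟩ := Nat.exists_eq_add_of_le' hk
    rw [Finset.sum_const, Finset.card_range, smul_eq_mul]
    rw [show 2 * (j + 1) - 1 = 2 * j + 1 by omega]
    symm
    apply Nat.sub_eq_of_eq_add
    ring
  · intro t ht
    rw [Finset.mem_range] at ht
    have h₁ : Nat.dist (row t) (row (t + 1)) = 1 := by
      simp only [row, Nat.dist]; split_ifs <;> omega
    have h₂ : Nat.dist (row (2 * k + t)) (row (2 * k + t + 1)) = 1 := by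
      simp only [row, Nat.dist]; split_ifs <;> omega
    have h₃ : Nat.dist (col t) (col (t + 1)) = t + 1 := by
      simp only [col, Nat.dist]; split_ifs <;> omega
    have h₄ : Nat.dist (col (2 * k + t)) (col (2 * k + t + 1)) = 2 * k - 1 - t := by
      simp only [col, Nat.dist]; split_ifs <;> omega
    omega

theorem exists_walkLen_odd (k : ℕ) (hk : 1 ≤ k) :
    ∃ σ, walkLen 2 (2 * k + 1) σ = (2 * k + 1 + 1) ^ 2 - 4 := by
  let row : ℕ → ℕ := fun t => t % 2
  let col : ℕ → ℕ := fun t =>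
    if t < 2 * k + 1 then (if t % 2 = 0 then k + t / 2 else k - 1 - t / 2)
    else if t = 2 * k + 1 then k
    else (if t % 2 = 0 then t / 2 - k - 1 else 3 * k + 1 - t / 2)
  obtain ⟨σ, hσ⟩ := exists_walkLen_eq (2 * k + 1) row col
    (by intro t ht; simp only [row]; omega)
    (by intro t ht; simp only [col]; split_ifs <;> omega)
    (by intro s hs t ht; simp only [row, col]; split_ifs <;> omega)
  have hrow : ∀ t, Nat.dist (row t) (row (t + 1)) = 1 := by
    intro t; simp only [row, Nat.dist]; omega
  refine ⟨σ, hσ.trans ?_⟩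
  simp only [hrow]
  rw [sum_range_two_mul_sub_one _ (by omega)]
  obtain ⟨j, rfl⟩ := Nat.exists_eq_add_of_le' hk
  rw [show 2 * (j + 1) + 1 - 1 = 2 * j + 1 + 1 by omega, Finset.sum_range_succ',
    Finset.sum_congr rfl (g := fun _ => 2 * j + 6)]
  · have h₀ : Nat.dist (col 0) (col (0 + 1)) = 1 := by
      simp [col, Nat.dist, show 1 ≤ 2 * (j + 1) by omega]
    have h₁ : Nat.dist (col (2 * (j + 1) + 1 + 0)) (col (2 * (j + 1) + 1 + 0 + 1)) = j + 1 := by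
      simp only [col, Nat.dist]; split_ifs <;> omega
    have h₂ : Nat.dist (col (2 * j + 1 + 1)) (col (2 * j + 1 + 1 + 1)) = j + 1 := by
      simp only [col, Nat.dist]; split_ifs <;> omega
    rw [h₀, h₁, h₂, Finset.sum_const, Finset.card_range, smul_eq_mul]
    symm
    apply Nat.sub_eq_of_eq_add
    ring
  · intro t ht
    rw [Finset.mem_range] at ht
    have h₁ : Nat.dist (col (t + 1)) (col (t + 1 + 1)) = t + 2 := by
      simp only [col, Nat.dist]; split_ifs <;> omega
    have h₂ : Nat.dist (col (2 * (j + 1) + 1 + (t + 1))) (col (2 * (j + 1) + 1 + (t + 1) + 1)) =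
        2 * j + 2 - t := by
      simp only [col, Nat.dist]; split_ifs <;> omega
    omega

theorem maxWalk_two_rows (n : ℕ) (hn : 2 ≤ n) :
    maxWalk 2 n ∈ ({(n + 1) ^ 2 - 4, (n + 1) ^ 2 - 4 + 1} : Set ℕ) := by
  have hex : ∃ σ, walkLen 2 n σ = (n + 1) ^ 2 - 4 := by
    rcases Nat.even_or_odd' n with ⟨k, rfl | rfl⟩
    · exact exists_walkLen_even k (by omega)
    · exact exists_walkLen_odd k (by omega)
  have hub : (n + 1) ^ 2 - 3 ∈ upperBounds (Set.range (walkLen 2 n)) := by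
    rintro _ ⟨σ, rfl⟩
    exact walkLen_le_s3 n hn σ
  have hlo : (n + 1) ^ 2 - 4 ≤ maxWalk 2 n := le_csSup ⟨_, hub⟩ hex
  have hhi : maxWalk 2 n ≤ (n + 1) ^ 2 - 3 := csSup_le ⟨_, hex⟩ hub
  simp only [Set.mem_insert_iff, Set.mem_singleton_iff]
  omega
end

section
/- Let m, n ≥ 3 be natural numbers, both odd. Then there exists a bijection σ : V → [mn], where V = {(i,j) : i ∈ [m], j ∈ [n]}, such that Σ_{t=1}^{mn−1} d(σ⁻¹(t), σ⁻¹(t+1)) = mn(m+n)/2 − (m+n)/2 − 1. -/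
/-- An enumeration of the grid points of `[0, 2a] × [0, 2b]` lying strictly above the row through
the centre `(a, b)`, column by column from right to left, followed by those on that row to the left
of the centre. -/
def halfPath (a b k : ℕ) : ℕ × ℕ :=
  if k < (2 * a + 1) * b then (2 * a - k / b, b + 1 + k % b) else (k - (2 * a + 1) * b, b)

/-- The walk starting at the centre and visiting each point of `halfPath` followed by its reflection
through the centre. -/
def centralPath (a b t : ℕ) : ℕ × ℕ :=
  if t = 0 then (a, b)
  else if t % 2 = 1 then halfPath a b ((t - 1) / 2)
  else (2 * a - (halfPath a b ((t - 1) / 2)).1, 2 * b - (halfPath a b ((t - 1) / 2)).2)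

theorem halfPath_bounds {a b k : ℕ} (hk : k < (2 * a + 1) * b + a) :
    (halfPath a b k).1 ≤ 2 * a ∧ b ≤ (halfPath a b k).2 ∧ (halfPath a b k).2 ≤ 2 * b ∧
      ((halfPath a b k).2 = b → (halfPath a b k).1 < a) := by
  unfold halfPath
  split_ifs with h
  · have hb : 0 < b := Nat.pos_of_mul_pos_left (by omega : 0 < (2 * a + 1) * b)
    have := Nat.mod_lt k hb
    refine ⟨Nat.sub_le _ _, ?_, ?_, ?_⟩ <;> dsimp only <;> omega
  · refine ⟨?_, ?_, ?_, ?_⟩ <;> dsimp only <;> omega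

theorem halfPath_injective {a b k l : ℕ} (hkl : halfPath a b k = halfPath a b l) : k = l := by
  unfold halfPath at hkl
  split_ifs at hkl with hk hl hl <;> simp only [Prod.mk.injEq] at hkl
  · have h1 : k / b < 2 * a + 1 := Nat.div_lt_of_lt_mul (by rwa [mul_comm])
    have h2 : l / b < 2 * a + 1 := Nat.div_lt_of_lt_mul (by rwa [mul_comm])
    have h3 : k / b = l / b := by omega
    rw [← Nat.div_add_mod k b, ← Nat.div_add_mod l b, h3]
    omega
  all_goals omega

theorem halfPath_step {a b k : ℕ} (hk : k + 1 < (2 * a + 1) * b + a) :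
    ((halfPath a b k).1 ≤ a ∧ (halfPath a b (k + 1)).1 ≤ a) ∨
      (a ≤ (halfPath a b k).1 ∧ a ≤ (halfPath a b (k + 1)).1) := by
  unfold halfPath
  split_ifs with h1 h2 h2 <;> dsimp only
  · have := Nat.succ_div (a := k) (b := b)
    split_ifs at this <;> omega
  · have hb : 0 < b := Nat.pos_of_mul_pos_left (by omega : 0 < (2 * a + 1) * b)
    have : 2 * a ≤ k / b := by
      rw [Nat.le_div_iff_mul_le hb]
      nlinarith
    omega
  · omega
  · omega

theorem centralPath_le {a b t : ℕ} (ht : t < (2 * a + 1) * (2 * b + 1)) :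
    (centralPath a b t).1 ≤ 2 * a ∧ (centralPath a b t).2 ≤ 2 * b := by
  have e : (2 * a + 1) * (2 * b + 1) = 2 * ((2 * a + 1) * b) + 2 * a + 1 := by ring
  unfold centralPath
  split_ifs with h1 h2
  · dsimp only; omega
  · have := halfPath_bounds (a := a) (b := b) (k := (t - 1) / 2) (by omega)
    exact ⟨this.1, this.2.2.1⟩
  · dsimp only; omega

theorem centralPath_injOn {a b s t : ℕ} (hs : s < (2 * a + 1) * (2 * b + 1))
    (ht : t < (2 * a + 1) * (2 * b + 1)) (hst : centralPath a b s = centralPath a b t) :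
    s = t := by
  have e : (2 * a + 1) * (2 * b + 1) = 2 * ((2 * a + 1) * b) + 2 * a + 1 := by ring
  have key : halfPath a b ((s - 1) / 2) = halfPath a b ((t - 1) / 2) →
      (s - 1) / 2 = (t - 1) / 2 := halfPath_injective
  have hs' : s ≠ 0 → _ := fun h ↦
    halfPath_bounds (a := a) (b := b) (k := (s - 1) / 2) (by omega)
  have ht' : t ≠ 0 → _ := fun h ↦
    halfPath_bounds (a := a) (b := b) (k := (t - 1) / 2) (by omega)
  rw [Prod.ext_iff] at key
  unfold centralPath at hst
  split_ifs at hst <;> rw [Prod.ext_iff] at hst <;> try dsimp only at hst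
  all_goals omega

/-- Consecutive points of `centralPath` lie in opposite closed quadrants, so their Manhattan
distance is the sum of their distances to the centre. -/
theorem dist_centralPath_succ {a b t : ℕ} (ht : t + 1 < (2 * a + 1) * (2 * b + 1)) :
    Nat.dist (centralPath a b t).1 (centralPath a b (t + 1)).1 +
        Nat.dist (centralPath a b t).2 (centralPath a b (t + 1)).2 =
      (Nat.dist (centralPath a b t).1 a + Nat.dist (centralPath a b t).2 b) +
        (Nat.dist (centralPath a b (t + 1)).1 a + Nat.dist (centralPath a b (t + 1)).2 b) := by
  have e : (2 * a + 1) * (2 * b + 1) = 2 * ((2 * a + 1) * b) + 2 * a + 1 := by ring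
  have hb := halfPath_bounds (a := a) (b := b) (k := t / 2) (by omega)
  rcases Nat.eq_zero_or_pos t with rfl | h0
  · simp [centralPath, Nat.dist]
    omega
  rcases Nat.mod_two_eq_zero_or_one t with h | h
  · have hb' := halfPath_bounds (a := a) (b := b) (k := (t - 1) / 2) (by omega)
    have hs := halfPath_step (a := a) (b := b) (k := (t - 1) / 2) (by omega)
    have e1 : (t - 1) / 2 + 1 = t / 2 := by omega
    rw [e1] at hs
    simp only [centralPath, Nat.dist, h0.ne', h, Nat.succ_ne_zero, if_false, Nat.add_sub_cancel,
      show (t + 1) % 2 = 1 by omega, if_true, Nat.zero_ne_one]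
    omega
  · have e1 : (t - 1) / 2 = t / 2 := by omega
    simp only [centralPath, Nat.dist, h0.ne', h, Nat.succ_ne_zero, if_false, Nat.add_sub_cancel,
      show (t + 1) % 2 = 0 by omega, if_true, Nat.zero_ne_one, e1]
    omega

theorem sum_dist_centre (a : ℕ) : ∑ i ∈ Finset.range (2 * a + 1), Nat.dist i a = a * (a + 1) := by
  induction a with
  | zero => simp
  | succ a ih =>
    rw [show 2 * (a + 1) + 1 = (2 * a + 1 + 1) + 1 by ring, Finset.sum_range_succ',
      Finset.sum_range_succ]
    simp only [Nat.dist_add_add_right, ih]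
    have h1 : Nat.dist (2 * a + 1) a = a + 1 := by unfold Nat.dist; omega
    have h2 : Nat.dist 0 (a + 1) = a + 1 := by unfold Nat.dist; omega
    rw [h1, h2]
    ring

theorem sum_grid_dist_centre (a b : ℕ) :
    ∑ p : Fin (2 * a + 1) × Fin (2 * b + 1), (Nat.dist p.1 a + Nat.dist p.2 b) =
      (2 * b + 1) * (a * (a + 1)) + (2 * a + 1) * (b * (b + 1)) := by
  rw [Fintype.sum_prod_type]
  simp only [Finset.sum_add_distrib, Finset.sum_const, Finset.card_univ, Fintype.card_fin,
    smul_eq_mul, ← Finset.mul_sum]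
  rw [Fin.sum_univ_eq_sum_range (fun i ↦ Nat.dist i a), sum_dist_centre,
    Fin.sum_univ_eq_sum_range (fun i ↦ Nat.dist i b), sum_dist_centre]

theorem sum_add_succ_add_ends (w : ℕ → ℕ) (N : ℕ) :
    ∑ t ∈ Finset.range N, (w t + w (t + 1)) + (w 0 + w N) =
      2 * ∑ t ∈ Finset.range (N + 1), w t := by
  rw [Finset.sum_add_distrib]
  linarith [Finset.sum_range_succ w N, Finset.sum_range_succ' w N]

theorem exists_equiv_centralPath (a b : ℕ) :
    ∃ σ : Fin (2 * a + 1) × Fin (2 * b + 1) ≃ Fin ((2 * a + 1) * (2 * b + 1)),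
      ∀ t, (((σ.symm t).1 : ℕ), ((σ.symm t).2 : ℕ)) = centralPath a b t := by
  let f : Fin ((2 * a + 1) * (2 * b + 1)) → Fin (2 * a + 1) × Fin (2 * b + 1) := fun t ↦
    (⟨(centralPath a b t).1, Nat.lt_succ_of_le (centralPath_le t.2).1⟩,
      ⟨(centralPath a b t).2, Nat.lt_succ_of_le (centralPath_le t.2).2⟩)
  have hf : Function.Bijective f := by
    rw [Fintype.bijective_iff_injective_and_card]
    refine ⟨fun s t hst ↦ Fin.ext (centralPath_injOn s.2 t.2 ?_), by simp⟩
    simpa [f, Prod.ext_iff] using hst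
  exact ⟨(Equiv.ofBijective f hf).symm, fun t ↦ rfl⟩

theorem exists_walk_odd_odd (m n : ℕ) (hm : 3 ≤ m) (hn : 3 ≤ n)
    (hmo : Odd m) (hno : Odd n) :
    ∃ σ : Fin m × Fin n ≃ Fin (m * n),
      walkLen m n σ = m * n * (m + n) / 2 - (m + n) / 2 - 1 := by
  obtain ⟨a, rfl⟩ := hmo
  obtain ⟨b, rfl⟩ := hno
  obtain ⟨σ, hσ⟩ := exists_equiv_centralPath a b
  refine ⟨σ, ?_⟩
  have h1 (t) : ((σ.symm t).1 : ℕ) = (centralPath a b t).1 := congrArg Prod.fst (hσ t)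
  have h2 (t) : ((σ.symm t).2 : ℕ) = (centralPath a b t).2 := congrArg Prod.snd (hσ t)
  let w : ℕ → ℕ := fun t ↦ Nat.dist (centralPath a b t).1 a + Nat.dist (centralPath a b t).2 b
  have hN : (2 * a + 1) * (2 * b + 1) = 2 * ((2 * a + 1) * b + a) + 1 := by ring
  have hwalk : walkLen _ _ σ =
      ∑ t ∈ Finset.range ((2 * a + 1) * (2 * b + 1) - 1), (w t + w (t + 1)) := by
    rw [walkLen, ← Fin.sum_univ_eq_sum_range (fun t ↦ w t + w (t + 1))]
    refine Finset.sum_congr rfl fun t _ ↦ ?_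
    simp only [gridDist, h1, h2]
    exact dist_centralPath_succ (Nat.add_lt_of_lt_sub t.2)
  have hsum : ∑ t ∈ Finset.range ((2 * a + 1) * (2 * b + 1)), w t =
      (2 * b + 1) * (a * (a + 1)) + (2 * a + 1) * (b * (b + 1)) := by
    rw [← sum_grid_dist_centre, ← Fin.sum_univ_eq_sum_range w, ← Equiv.sum_comp σ.symm]
    simp only [h1, h2, w]
  have hends := sum_add_succ_add_ends w ((2 * a + 1) * (2 * b + 1) - 1)
  have hfirst : w 0 = 0 := by simp [w, centralPath]
  have hlast : w ((2 * a + 1) * (2 * b + 1) - 1) = 1 := by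
    have e : (2 * ((2 * a + 1) * b + a) - 1) / 2 = (2 * a + 1) * b + (a - 1) := by omega
    have e' : 2 * ((2 * a + 1) * b + a) ≠ 0 := by omega
    simp only [w, hN, Nat.add_sub_cancel, centralPath, halfPath, e, e', Nat.mul_mod_right,
      if_false, Nat.zero_ne_one, Nat.not_lt.2 (Nat.le_add_right _ _), Nat.add_sub_cancel_left,
      Nat.dist]
    omega
  rw [Nat.sub_add_cancel (by omega), hsum, hfirst, hlast, ← hwalk] at hends
  have e1 : (2 * a + 1) * (2 * b + 1) * (2 * a + 1 + (2 * b + 1)) / 2 =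
      (2 * a + 1) * (2 * b + 1) * (a + b + 1) := by
    rw [show (2 * a + 1) * (2 * b + 1) * (2 * a + 1 + (2 * b + 1)) =
      2 * ((2 * a + 1) * (2 * b + 1) * (a + b + 1)) by ring]
    omega
  have e2 : (2 * a + 1 + (2 * b + 1)) / 2 = a + b + 1 := by omega
  rw [e1, e2]
  have e3 : (2 * a + 1) * (2 * b + 1) * (a + b + 1) =
      2 * ((2 * b + 1) * (a * (a + 1)) + (2 * a + 1) * (b * (b + 1))) + (a + b + 1) := by ring
  omega
end
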